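/- Fix n ≥ 1, a covariate matrix X ∈ ℝ^{n×d}, group labels Z ∈ {1,…,H}ⁿ, a symmetric positive semidefinite kernel K, a known positive definite matrix Σ ∈ ℝ^{n×n}, δ₀, σ₀ > 0, and γ ∈ ℝ, and suppose Y ∈ ℝⁿ is multivariate Gaussian with mean 0 and covariance (δ₀²/n^{1−γ})·K_n + σ₀²·Σ. Fix a permutation size b ∈ {1,…,n}, any test statistic T, and α₀ ∈ (0,1). Let ξ_n = (δ₀²/n^{1−γ})/σ₀², let ζ_1 ≥ … ≥ ζ_n be the eigenvalues of K_n^C = Σ^{−1/2}K_nΣ^{−1/2}, let ω̃_C(b, ξ_n, Σ) = ξ_n·ζ_{n−b+1}, and let ṽ_C(b, ξ_n, Σ, α₀) = (1/2)·exp{(1/2)·ω̃_C(b, ξ_n, Σ)·Q_b(1−α₀)} − 1/2. Then the corrected partial permutation p-value p̃_c(X,Y,Z,Σ) = p(X,Y,Z,Σ) + ṽ_C(b, ξ_n, Σ, α₀) + α₀ (with p either the discrete or the continuous partial permutation p-value with kernel K, permutation size b, and covariance matrix Σ) is valid: Pr(p̃_c(X,Y,Z,Σ) ≤ α) ≤ α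 for every α ∈ (0,1). -/

import Mathlib

open MeasureTheory ProbabilityTheory Filter

noncomputable section

namespace PPT

/-- The law of `k` i.i.d. standard Gaussian random variables. -/
def stdGaussianPi (k : ℕ) : Measure (Fin k → ℝ) :=
  Measure.pi fun _ => gaussianReal 0 1

/-- The law of `n` i.i.d. centered Gaussian noises with standard deviation `σ`. -/
def noiseLaw (n : ℕ) (σ : ℝ) : Measure (Fin n → ℝ) :=
  Measure.pi fun _ => gaussianReal 0 ((σ ^ 2).toNNReal)

/-- Matrix (given as a function) times vector. -/
def mulVecF {n m : ℕ} (A : Fin n → Fin m → ℝ) (v : Fin m → ℝ) : Fin n → ℝ :=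
  fun i => ∑ j, A i j * v j

/-- Transposed matrix times vector, `Aᵀ v`. -/
def tmulVecF {n : ℕ} (A : Fin n → Fin n → ℝ) (v : Fin n → ℝ) : Fin n → ℝ :=
  fun i => ∑ j, A j i * v j

/-- Matrix product of matrices given as functions. -/
def mulF {n : ℕ} (A B : Fin n → Fin n → ℝ) : Fin n → Fin n → ℝ :=
  fun i j => ∑ k, A i k * B k j

/-- The identity matrix as a function. -/
def idF (n : ℕ) : Fin n → Fin n → ℝ :=
  fun i j => if i = j then 1 else 0

/-- Quadratic form `vᵀ A v`. -/
def quadForm {n : ℕ} (A : Fin n → Fin n → ℝ) (v : Fin n → ℝ) : ℝ :=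
  ∑ i, ∑ j, v i * A i j * v j

/-- `A` is an orthogonal matrix: `A Aᵀ = I`. -/
def IsOrthogonalF {n : ℕ} (A : Fin n → Fin n → ℝ) : Prop :=
  ∀ i j, (∑ k, A i k * A j k) = if i = j then (1 : ℝ) else 0

/-- `(Γ, c)` is an eigendecomposition `Kmat = Γ diag(c) Γᵀ` of `Kmat`, with `Γ` orthogonal and
the eigenvalues `c` nonnegative and in nonincreasing order. -/
def IsEigenDecomp {n : ℕ} (Kmat Γ : Fin n → Fin n → ℝ) (c : Fin n → ℝ) : Prop :=
  IsOrthogonalF Γ ∧ (∀ i j, Kmat i j = ∑ k, Γ i k * c k * Γ j k) ∧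
    (∀ i j : Fin n, i ≤ j → c j ≤ c i) ∧ (∀ i, 0 ≤ c i)

/-- A symmetric positive semidefinite kernel on `ℝᵈ`. -/
def IsPSDKernel {d : ℕ} (K : (Fin d → ℝ) → (Fin d → ℝ) → ℝ) : Prop :=
  (∀ x y, K x y = K y x) ∧
    ∀ (m : ℕ) (v : Fin m → (Fin d → ℝ)) (a : Fin m → ℝ),
      0 ≤ ∑ i, ∑ j, a i * a j * K (v i) (v j)

/-- The set `M(n,b)` of permutations of `{0, …, n-1}` keeping the first `n - b` elements fixed. -/
def permSet (n b : ℕ) : Finset (Equiv.Perm (Fin n)) :=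
  Finset.univ.filter fun ψ => ∀ i : Fin n, (i : ℕ) < n - b → ψ i = i

/-- The discrete partial permutation p-value, with covariates `X`, group labels `Z`,
test statistic `T`, eigenvector matrix `Γ`, permutation size `b` and responses `Y`. -/
def pDisc {n d H : ℕ} (X : Fin n → Fin d → ℝ) (Z : Fin n → Fin H)
    (T : (Fin n → Fin d → ℝ) → (Fin n → ℝ) → (Fin n → Fin H) → ℝ)
    (Γ : Fin n → Fin n → ℝ) (b : ℕ) (Y : Fin n → ℝ) : ℝ :=
  ((permSet n b).card : ℝ)⁻¹ *
    ∑ ψ ∈ permSet n b,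
      if T X Y Z ≤ T X (mulVecF Γ ((tmulVecF Γ Y) ∘ ψ)) Z then 1 else 0

/-- Squared norm of the last `b` coordinates of a vector in `ℝⁿ`. -/
def tailNormSq {n : ℕ} (b : ℕ) (w : Fin n → ℝ) : ℝ :=
  ∑ i ∈ Finset.univ.filter (fun i : Fin n => n - b ≤ (i : ℕ)), w i ^ 2

/-- The continuous partial permutation of `w` driven by `g`: it agrees with `w` on the first
`n - b` coordinates, and its last `b` coordinates are those of `g` rescaled to lie on the sphere
of radius `(Σ_{i ≥ n-b} w i ^ 2)^{1/2}`.  When `g` is standard Gaussian, the last `b` coordinates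
are uniformly distributed on that sphere. -/
def wStar {n : ℕ} (b : ℕ) (w g : Fin n → ℝ) : Fin n → ℝ := fun i =>
  if (i : ℕ) < n - b then w i
  else Real.sqrt (tailNormSq b w) * g i / Real.sqrt (tailNormSq b g)

/-- The continuous partial permutation p-value. -/
def pCont {n d H : ℕ} (X : Fin n → Fin d → ℝ) (Z : Fin n → Fin H)
    (T : (Fin n → Fin d → ℝ) → (Fin n → ℝ) → (Fin n → Fin H) → ℝ)
    (Γ : Fin n → Fin n → ℝ) (b : ℕ) (Y : Fin n → ℝ) : ℝ :=
  (stdGaussianPi n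
    {g | T X Y Z ≤ T X (mulVecF Γ (wStar b (tmulVecF Γ Y) g)) Z}).toReal

/-- The chi-squared distribution with `k` degrees of freedom, realized as the law of the sum of
squares of `k` independent standard Gaussians. -/
def chiSq (k : ℕ) : Measure ℝ :=
  Measure.map (fun g : Fin k → ℝ => ∑ i, g i ^ 2) (stdGaussianPi k)

/-- The quantile function of the chi-squared distribution with `k` degrees of freedom. -/
def chiSqQuantile (k : ℕ) (p : ℝ) : ℝ :=
  sInf {x : ℝ | ENNReal.ofReal p ≤ chiSq k (Set.Iic x)}

end PPT

namespace PPT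

/-- A square matrix (as a function) is symmetric. -/
def IsSymmF {n : ℕ} (A : Fin n → Fin n → ℝ) : Prop := ∀ i j, A i j = A j i

/-- A square matrix (as a function) is symmetric positive definite. -/
def IsPosDefF {n : ℕ} (A : Fin n → Fin n → ℝ) : Prop :=
  IsSymmF A ∧ ∀ v : Fin n → ℝ, v ≠ 0 → 0 < quadForm A v

/-- `(Sh, R)` is the pair `(Σ^{1/2}, Σ^{-1/2})` associated with the positive definite matrix
`Sm`: `Sh` is the symmetric positive definite square root of `Sm` and `R` is its inverse. -/
def IsSqrtPair {n : ℕ} (Sm Sh R : Fin n → Fin n → ℝ) : Prop :=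
  IsPosDefF Sh ∧ mulF Sh Sh = Sm ∧ mulF R Sh = idF n ∧ mulF Sh R = idF n

end PPT


namespace PPT

open scoped ENNReal NNReal

lemma pi_gauss_density {ι : Type*} [Fintype ι] (v : ι → ℝ≥0) (hv : ∀ i, v i ≠ 0) :
    Measure.pi (fun i => gaussianReal 0 (v i)) =
      (volume : Measure (ι → ℝ)).withDensity (fun x => ∏ i, gaussianPDF 0 (v i) (x i)) := by
  classical
  refine Measure.pi_eq fun s hs => ?_
  rw [withDensity_apply _ (MeasurableSet.univ_pi hs), ← lintegral_indicator (MeasurableSet.univ_pi hs)]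
  have h1 : ∀ x : ι → ℝ, (Set.univ.pi s).indicator (fun x => ∏ i, gaussianPDF 0 (v i) (x i)) x
      = ENNReal.ofReal (∏ i, (s i).indicator (gaussianPDFReal 0 (v i)) (x i)) := by
    intro x
    rw [ENNReal.ofReal_prod_of_nonneg]
    · by_cases hx : x ∈ Set.univ.pi s
      · rw [Set.indicator_of_mem hx]
        refine Finset.prod_congr rfl fun i _ => ?_
        rw [Set.indicator_of_mem (hx i trivial)]
        rfl
      · rw [Set.indicator_of_notMem hx]
        simp only [Set.mem_pi, not_forall] at hx
        obtain ⟨i, _, hi⟩ := hx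
        symm
        apply Finset.prod_eq_zero (Finset.mem_univ i)
        rw [Set.indicator_of_notMem hi]; simp
    · intro i _
      exact Set.indicator_nonneg (fun y _ => gaussianPDFReal_nonneg _ _ _) _
  have hint : ∀ i, Integrable ((s i).indicator (gaussianPDFReal 0 (v i))) volume := fun i =>
    (integrable_gaussianPDFReal 0 (v i)).indicator (hs i)
  simp_rw [h1]
  rw [← ofReal_integral_eq_lintegral_ofReal]
  · rw [integral_fintype_prod_volume_eq_prod (𝕜 := ℝ)
      (f := fun i => (s i).indicator (gaussianPDFReal 0 (v i)))]
    rw [ENNReal.ofReal_prod_of_nonneg]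
    · refine Finset.prod_congr rfl fun i _ => ?_
      rw [integral_indicator (hs i), gaussianReal_apply_eq_integral _ (hv i)]
    · intro i _
      exact integral_nonneg fun y => Set.indicator_nonneg (fun y _ => gaussianPDFReal_nonneg _ _ _) _
  · exact Integrable.fintype_prod (f := fun i => (s i).indicator (gaussianPDFReal 0 (v i))) hint
  · exact Eventually.of_forall fun x => Finset.prod_nonneg fun i _ =>
      Set.indicator_nonneg (fun y _ => gaussianPDFReal_nonneg _ _ _) _

lemma lintegral_polar {E : Type*} [NormedAddCommGroup E] [NormedSpace ℝ E] [MeasurableSpace E]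
    [BorelSpace E] [FiniteDimensional ℝ E] [Nontrivial E] (μ : Measure E) [μ.IsAddHaarMeasure]
    (F : E → ℝ≥0∞) (hF : Measurable F) :
    ∫⁻ x, F x ∂μ = ∫⁻ θ, ∫⁻ r, F ((r : ℝ) • (θ : E))
      ∂(Measure.volumeIoiPow (Module.finrank ℝ E - 1)) ∂μ.toSphere := by
  have h1 : ∫⁻ x, F x ∂μ = ∫⁻ x : ({(0)}ᶜ : Set E), F x ∂(μ.comap (↑)) := by
    rw [lintegral_subtype_comap (measurableSet_singleton _).compl F,
        restrict_compl_singleton]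
  rw [h1, ← lintegral_prod (f := fun p : Metric.sphere (0:E) 1 × Set.Ioi (0:ℝ) =>
    F ((p.2 : ℝ) • (p.1 : E)))]
  · rw [← μ.measurePreserving_homeomorphUnitSphereProd.lintegral_comp_emb
        (Homeomorph.measurableEmbedding _)]
    refine lintegral_congr fun x => ?_
    congr 1
    have hx : (x : E) ≠ 0 := x.2
    simp [homeomorphUnitSphereProd, smul_smul, hx]
  · apply Measurable.aemeasurable
    fun_prop

lemma radial_resample {E : Type*} [NormedAddCommGroup E] [NormedSpace ℝ E] [MeasurableSpace E]
    [BorelSpace E] [FiniteDimensional ℝ E] [Nontrivial E] (μ : Measure E) [μ.IsAddHaarMeasure]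
    (ρ1 ρ2 : ℝ → ℝ≥0∞) (h1 : Measurable ρ1) (h2 : Measurable ρ2)
    (hp2 : ∫⁻ x, ρ2 ‖x‖ ∂μ = 1)
    (F : E → ℝ≥0∞) (hF : Measurable F) :
    ∫⁻ x, ρ1 ‖x‖ * ∫⁻ y, ρ2 ‖y‖ * F (‖x‖ • (‖y‖⁻¹ • y)) ∂μ ∂μ = ∫⁻ x, ρ1 ‖x‖ * F x ∂μ := by
  have hnorm : ∀ (r : Set.Ioi (0:ℝ)) (θ : Metric.sphere (0:E) 1), ‖(r:ℝ) • (θ:E)‖ = r := by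
    intro r θ
    rw [norm_smul, norm_eq_of_mem_sphere, mul_one, Real.norm_of_nonneg (le_of_lt r.2)]
  set τ := Measure.volumeIoiPow (Module.finrank ℝ E - 1)
  set σ := μ.toSphere
  have e2 : (∫⁻ r, ρ2 (r : ℝ) ∂τ) * σ Set.univ = 1 := by
    rw [← hp2, lintegral_polar μ _ (by fun_prop)]
    simp_rw [hnorm]
    rw [lintegral_const]
  have inner : ∀ x : E, ∫⁻ y, ρ2 ‖y‖ * F (‖x‖ • (‖y‖⁻¹ • y)) ∂μ =
      (∫⁻ r, ρ2 (r : ℝ) ∂τ) * ∫⁻ θ, F (‖x‖ • (θ : E)) ∂σ := by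
    intro x
    rw [lintegral_polar μ _ (by fun_prop)]
    rw [← lintegral_const_mul _ (by fun_prop)]
    refine lintegral_congr fun θ => ?_
    rw [← lintegral_mul_const _ (by fun_prop)]
    refine lintegral_congr fun r => ?_
    rw [hnorm, smul_smul ((r : ℝ)⁻¹), inv_mul_cancel₀ (ne_of_gt r.2), one_smul]
  simp_rw [inner]
  rw [lintegral_polar μ _ ?_, lintegral_polar μ _ (by fun_prop)]
  · simp_rw [hnorm]
    rw [lintegral_const]
    rw [lintegral_lintegral_swap (by fun_prop)]
    rw [← lintegral_mul_const' _ _ (measure_ne_top _ _)]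
    refine lintegral_congr fun r => ?_
    rw [lintegral_const_mul _ (by fun_prop)]
    calc ρ1 r * ((∫⁻ r, ρ2 (r : ℝ) ∂τ) * ∫⁻ θ, F ((r : ℝ) • (θ : E)) ∂σ) * σ Set.univ
        = ρ1 r * (((∫⁻ r, ρ2 (r : ℝ) ∂τ) * σ Set.univ) * ∫⁻ θ, F ((r : ℝ) • (θ : E)) ∂σ) := by ring
      _ = _ := by rw [e2, one_mul]
  · refine Measurable.mul (by fun_prop) (Measurable.const_mul ?_ _)
    exact Measurable.lintegral_prod_right' (f := fun p : E × Metric.sphere (0:E) 1 =>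
      F (‖p.1‖ • (p.2 : E))) (by fun_prop)

end PPT

namespace PPT

open scoped ENNReal NNReal

/-- Radial profile of the centered isotropic Gaussian density. -/
def gaussRad (k : ℕ) (v : ℝ≥0) (r : ℝ) : ℝ≥0∞ :=
  ENNReal.ofReal ((√(2 * Real.pi * v))⁻¹ ^ k * Real.exp (- r ^ 2 / (2 * v)))

lemma measurable_gaussRad (k : ℕ) (v : ℝ≥0) : Measurable (gaussRad k v) := by
  unfold gaussRad; fun_prop

lemma gauss_iso {ι : Type*} [Fintype ι] (v : ℝ≥0) (hv : v ≠ 0) (G : (ι → ℝ) → ℝ≥0∞)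
    (hG : Measurable G) :
    ∫⁻ x, G x ∂(Measure.pi (fun _ : ι => gaussianReal 0 v)) =
      ∫⁻ z : EuclideanSpace ℝ ι, gaussRad (Fintype.card ι) v ‖z‖ * G z.ofLp := by
  rw [pi_gauss_density _ (fun _ => hv), lintegral_withDensity_eq_lintegral_mul _ _ hG]
  · rw [← (PiLp.volume_preserving_ofLp ι).lintegral_comp_emb
      (MeasurableEquiv.toLp 2 (ι → ℝ)).symm.measurableEmbedding]
    refine lintegral_congr fun z => ?_
    simp only [Pi.mul_apply]
    congr 1
    unfold gaussRad gaussianPDF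
    rw [← ENNReal.ofReal_prod_of_nonneg (fun i _ => gaussianPDFReal_nonneg _ _ _)]
    congr 1
    simp only [gaussianPDFReal, Finset.prod_mul_distrib, Finset.prod_const, ← Real.exp_sum]
    rw [EuclideanSpace.real_norm_sq_eq]
    simp [Finset.sum_div, Finset.sum_neg_distrib, neg_div]
  · exact Finset.measurable_prod _ fun i _ => (measurable_gaussianPDF 0 v).comp (measurable_pi_apply i)

lemma gauss_resample {ι : Type*} [Fintype ι] [Nonempty ι] (v : ℝ≥0) (hv : v ≠ 0)
    (F : (ι → ℝ) → ℝ≥0∞) (hF : Measurable F) :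
    ∫⁻ x, ∫⁻ y, F (fun i => √(∑ j, x j ^ 2) * y i / √(∑ j, y j ^ 2))
      ∂(Measure.pi (fun _ : ι => gaussianReal 0 1)) ∂(Measure.pi (fun _ : ι => gaussianReal 0 v))
      = ∫⁻ x, F x ∂(Measure.pi (fun _ : ι => gaussianReal 0 v)) := by
  have hm : Measurable fun p : (ι → ℝ) × (ι → ℝ) =>
      F (fun i => √(∑ j, p.1 j ^ 2) * p.2 i / √(∑ j, p.2 j ^ 2)) := by
    apply hF.comp
    refine measurable_pi_lambda _ fun i => ?_
    fun_prop
  rw [gauss_iso v hv _ hm.lintegral_prod_right', gauss_iso v hv _ hF]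
  rw [← radial_resample volume _ (gaussRad (Fintype.card ι) 1) (measurable_gaussRad _ _)
    (measurable_gaussRad _ _) ?_ (fun z : EuclideanSpace ℝ ι => F z.ofLp) (by fun_prop)]
  · refine lintegral_congr fun x => ?_
    congr 1
    refine (gauss_iso 1 one_ne_zero _ (hm.comp (measurable_prodMk_left (x := x.ofLp)))).trans ?_
    refine lintegral_congr fun y => ?_
    have hy : (fun i => √(∑ j, x.ofLp j ^ 2) * y.ofLp i / √(∑ j, y.ofLp j ^ 2)) =
        (‖x‖ • (‖y‖⁻¹ • y)).ofLp := by
      funext i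
      simp [EuclideanSpace.norm_eq]
      ring
    simp only [Function.comp_apply, hy]
  · have := gauss_iso (ι := ι) 1 one_ne_zero (fun _ => 1) measurable_const
    simpa using this.symm

instance instStdProb (k : ℕ) : IsProbabilityMeasure (stdGaussianPi k) := by
  unfold stdGaussianPi; infer_instance

lemma tailNormSq_eq {n : ℕ} (b : ℕ) (w : Fin n → ℝ) :
    tailNormSq b w = ∑ i : {i : Fin n // ¬ ((i : ℕ) < n - b)}, w i ^ 2 := by
  unfold tailNormSq
  simp_rw [← not_lt]
  exact Finset.sum_subtype _ (by simp) _

lemma measurable_wStar {n : ℕ} (b : ℕ) :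
    Measurable fun p : (Fin n → ℝ) × (Fin n → ℝ) => wStar b p.1 p.2 := by
  refine measurable_pi_lambda _ fun i => ?_
  unfold wStar tailNormSq
  split_ifs
  · fun_prop
  · fun_prop

lemma wStar_resample {n : ℕ} (b : ℕ) (hb1 : 1 ≤ b) (hb2 : b ≤ n) (v : Fin n → ℝ≥0)
    (v0 : ℝ≥0) (hv0 : v0 ≠ 0) (hv : ∀ i : Fin n, ¬ ((i : ℕ) < n - b) → v i = v0)
    (F : (Fin n → ℝ) → ℝ≥0∞) (hF : Measurable F) :
    ∫⁻ w, ∫⁻ g, F (wStar b w g) ∂(stdGaussianPi n) ∂(Measure.pi fun i => gaussianReal 0 (v i))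
      = ∫⁻ w, F w ∂(Measure.pi fun i => gaussianReal 0 (v i)) := by
  classical
  set p : Fin n → Prop := fun i => (i : ℕ) < n - b
  have hne : Nonempty {i // ¬ p i} := ⟨⟨⟨n - b, by omega⟩, by simp [p]⟩⟩
  set e := MeasurableEquiv.piEquivPiSubtypeProd (fun _ : Fin n => ℝ) p
  have mp := measurePreserving_piEquivPiSubtypeProd (fun i => gaussianReal 0 (v i)) p
  have mp1 := measurePreserving_piEquivPiSubtypeProd (fun _ : Fin n => gaussianReal 0 1) p
  have htail : (fun i : {i // ¬ p i} => gaussianReal 0 (v i)) = fun _ => gaussianReal 0 v0 := by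
    funext i; rw [hv i i.2]
  rw [htail] at mp
  have key : ∀ (G : (Fin n → ℝ) → ℝ≥0∞), Measurable G →
      ∫⁻ w, G w ∂(Measure.pi fun i => gaussianReal 0 (v i)) =
      ∫⁻ h, ∫⁻ t, G (e.symm (h, t)) ∂(Measure.pi (fun _ : {i // ¬ p i} => gaussianReal 0 v0))
        ∂(Measure.pi (fun i : {i // p i} => gaussianReal 0 (v i))) := by
    intro G hG
    rw [← (mp.symm e).lintegral_comp hG, lintegral_prod]
    exact (hG.comp e.symm.measurable).aemeasurable
  have key1 : ∀ (G : ({i // ¬ p i} → ℝ) → ℝ≥0∞), Measurable G →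
      ∫⁻ g, G (e g).2 ∂(stdGaussianPi n) =
      ∫⁻ t, G t ∂(Measure.pi (fun _ : {i // ¬ p i} => gaussianReal 0 1)) := by
    intro G hG
    have := (measurePreserving_snd.comp mp1).lintegral_comp hG
    exact this
  have hwS : ∀ h t g, wStar b (e.symm (h, t)) g =
      e.symm (h, fun i => √(∑ j, t j ^ 2) * (e g).2 i / √(∑ j, (e g).2 j ^ 2)) := by
    intro h t g
    have ht : tailNormSq b (e.symm (h, t)) = ∑ j, t j ^ 2 := by
      rw [tailNormSq_eq]
      refine Finset.sum_congr rfl fun i _ => ?_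
      have := i.2
      simp [e, MeasurableEquiv.piEquivPiSubtypeProd, Equiv.piEquivPiSubtypeProd, p] at *
      intro h; omega
    have hg : tailNormSq b g = ∑ j, (e g).2 j ^ 2 := by
      rw [tailNormSq_eq]; rfl
    funext i
    unfold wStar
    rw [ht, hg]
    by_cases hi : (i : ℕ) < n - b
    · simp [hi, e, MeasurableEquiv.piEquivPiSubtypeProd, Equiv.piEquivPiSubtypeProd, p]
    · simp [hi, e, MeasurableEquiv.piEquivPiSubtypeProd, Equiv.piEquivPiSubtypeProd, p]
  have hm : Measurable fun q : ((Fin n → ℝ) × (Fin n → ℝ)) => F (wStar b q.1 q.2) :=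
    hF.comp (measurable_wStar b)
  rw [key _ hm.lintegral_prod_right', key _ hF]
  refine lintegral_congr fun h => ?_
  have hFh : Measurable fun t => F (e.symm (h, t)) :=
    hF.comp (e.symm.measurable.comp measurable_prodMk_left)
  rw [← gauss_resample v0 hv0 _ hFh]
  refine lintegral_congr fun t => ?_
  simp_rw [hwS]
  refine key1 (fun y => F (e.symm (h, fun i => √(∑ j, t j ^ 2) * y i / √(∑ j, y j ^ 2)))) ?_
  apply hFh.comp
  refine measurable_pi_lambda _ fun i => ?_
  fun_prop

lemma rank_valid {Θ : Type*} [MeasurableSpace Θ] (ν : Measure Θ) [IsProbabilityMeasure ν]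
    (V : Θ → ℝ) (hV : Measurable V) (t : ℝ) (ht : 0 ≤ t) :
    ν {θ | (ν {θ' | V θ ≤ V θ'}).toReal ≤ t} ≤ ENNReal.ofReal t := by
  set m := ν.map V
  have : IsProbabilityMeasure m := Measure.isProbabilityMeasure_map hV.aemeasurable
  have hF : ∀ x, ν {θ' | x ≤ V θ'} = m (Set.Ici x) := by
    intro x; rw [Measure.map_apply hV measurableSet_Ici]; rfl
  simp_rw [hF]
  have hanti : Antitone fun x => m (Set.Ici x) := fun x y h =>
    measure_mono (Set.Ici_subset_Ici.2 h)
  have hB : MeasurableSet {x | (m (Set.Ici x)).toReal ≤ t} :=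
    measurableSet_le hanti.measurable.ennreal_toReal measurable_const
  have : ν {θ | (m (Set.Ici (V θ))).toReal ≤ t} = m {x | (m (Set.Ici x)).toReal ≤ t} := by
    rw [Measure.map_apply hV hB]; rfl
  rw [this, hB.measure_eq_iSup_isCompact_of_ne_top (measure_ne_top _ _)]
  refine iSup_le fun K => iSup_le fun hK => iSup_le fun hc => ?_
  rcases K.eq_empty_or_nonempty with rfl | hne
  · simp
  obtain ⟨x, hx, hmin⟩ := hc.exists_isLeast hne
  calc m K ≤ m (Set.Ici x) := measure_mono hmin
    _ ≤ ENNReal.ofReal t := (ENNReal.le_ofReal_iff_toReal_le (measure_ne_top _ _) ht).2 (hK hx)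

end PPT

namespace PPT

open scoped ENNReal NNReal

lemma tailNormSq_nonneg {n : ℕ} (b : ℕ) (w : Fin n → ℝ) : 0 ≤ tailNormSq b w :=
  Finset.sum_nonneg fun _ _ => sq_nonneg _

lemma wStar_wStar {n : ℕ} (b : ℕ) (w g g' : Fin n → ℝ) (hg : tailNormSq b g ≠ 0) :
    wStar b (wStar b w g) g' = wStar b w g' := by
  have h : tailNormSq b (wStar b w g) = tailNormSq b w := by
    have : tailNormSq b (wStar b w g) =
        ∑ i ∈ Finset.univ.filter (fun i : Fin n => n - b ≤ (i : ℕ)),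
          tailNormSq b w / tailNormSq b g * g i ^ 2 := by
      unfold tailNormSq
      refine Finset.sum_congr rfl fun i hi => ?_
      have hi' : ¬ ((i : ℕ) < n - b) := by simpa using hi
      unfold wStar
      rw [if_neg hi', div_pow, mul_pow, Real.sq_sqrt (tailNormSq_nonneg _ _),
        Real.sq_sqrt (tailNormSq_nonneg _ _)]
      unfold tailNormSq
      ring
    rw [this, ← Finset.mul_sum]
    exact div_mul_cancel₀ _ hg
  funext i
  unfold wStar at h ⊢
  rw [h]
  split_ifs <;> rfl

lemma tailNormSq_ae {n : ℕ} (b : ℕ) (hb1 : 1 ≤ b) (hb2 : b ≤ n) :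
    ∀ᵐ g ∂(stdGaussianPi n), tailNormSq b g ≠ 0 := by
  have h := (measurePreserving_eval (fun _ : Fin n => gaussianReal 0 1)
    ⟨n - b, by omega⟩).quasiMeasurePreserving.ae
      (p := fun x => x ≠ 0) (by
        have := nullSingletonClass_gaussianReal (μ := 0) (v := 1) one_ne_zero
        rw [ae_iff]; simp)
  unfold stdGaussianPi
  filter_upwards [h] with g hg h0
  apply hg
  unfold tailNormSq at h0
  rw [Finset.sum_eq_zero_iff_of_nonneg (fun _ _ => sq_nonneg _)] at h0
  have := h0 ⟨n - b, by omega⟩ (Finset.mem_filter.2 ⟨Finset.mem_univ _, le_rfl⟩)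
  simpa using this

set_option maxHeartbeats 2000000 in
lemma cont_valid {n : ℕ} (b : ℕ) (hb1 : 1 ≤ b) (hb2 : b ≤ n) (v : Fin n → ℝ≥0)
    (v0 : ℝ≥0) (hv0 : v0 ≠ 0) (hv : ∀ i : Fin n, ¬ ((i : ℕ) < n - b) → v i = v0)
    (u : (Fin n → ℝ) → ℝ) (hu : Measurable u) (t : ℝ) (ht : 0 ≤ t) :
    MeasurableSet {w | (stdGaussianPi n {g | u w ≤ u (wStar b w g)}).toReal ≤ t} ∧
    (Measure.pi fun i => gaussianReal 0 (v i))
      {w | (stdGaussianPi n {g | u w ≤ u (wStar b w g)}).toReal ≤ t} ≤ ENNReal.ofReal t := by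
  set S := {w | (stdGaussianPi n {g | u w ≤ u (wStar b w g)}).toReal ≤ t} with hSdef
  have hset : MeasurableSet {p : (Fin n → ℝ) × (Fin n → ℝ) | u p.1 ≤ u (wStar b p.1 p.2)} :=
    measurableSet_le (hu.comp measurable_fst) (hu.comp (measurable_wStar b))
  have hS : MeasurableSet S :=
    measurableSet_le (measurable_measure_prodMk_left hset).ennreal_toReal measurable_const
  refine ⟨hS, ?_⟩
  rw [← lintegral_indicator_one hS,
    ← wStar_resample b hb1 hb2 v v0 hv0 hv _ (measurable_one.indicator hS)]
  calc _ ≤ ∫⁻ w, ENNReal.ofReal t ∂(Measure.pi fun i => gaussianReal 0 (v i)) := ?_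
    _ = ENNReal.ofReal t := by simp
  refine lintegral_mono fun w => ?_
  have hVm : Measurable fun g => u (wStar b w g) :=
    hu.comp ((measurable_wStar b).comp measurable_prodMk_left)
  refine le_trans (le_of_eq ?_) (rank_valid (stdGaussianPi n) (fun g => u (wStar b w g)) hVm t ht)
  have hpre : MeasurableSet ((fun g => wStar b w g) ⁻¹' S) :=
    ((measurable_wStar b).comp measurable_prodMk_left) hS
  have : (fun g => S.indicator (1 : (Fin n → ℝ) → ℝ≥0∞) (wStar b w g)) =
      ((fun g => wStar b w g) ⁻¹' S).indicator 1 := by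
    funext g; simp [Set.indicator]
  calc _ = stdGaussianPi n ((fun g => wStar b w g) ⁻¹' S) := by
        rw [← lintegral_indicator_one hpre, ← this]
    _ = _ := by
        apply measure_congr
        filter_upwards [tailNormSq_ae b hb1 hb2] with g hg
        have e : ∀ g', wStar b (wStar b w g) g' = wStar b w g' := fun g' => wStar_wStar b w g g' hg
        have key : (wStar b w g ∈ S) =
            ((stdGaussianPi n {g' | u (wStar b w g) ≤ u (wStar b w g')}).toReal ≤ t) := by
          rw [hSdef, Set.mem_ofPred_eq]
          simp only [e]
        exact key

lemma one_mem_permSet (n b : ℕ) : (1 : Equiv.Perm (Fin n)) ∈ permSet n b := by simp [permSet]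

lemma mul_mem_permSet {n b : ℕ} {φ ψ : Equiv.Perm (Fin n)} (h1 : φ ∈ permSet n b)
    (h2 : ψ ∈ permSet n b) : φ * ψ ∈ permSet n b := by
  simp only [permSet, Finset.mem_filter, Finset.mem_univ, true_and] at *
  intro i hi
  rw [Equiv.Perm.mul_apply, h2 i hi, h1 i hi]

lemma inv_mem_permSet {n b : ℕ} {φ : Equiv.Perm (Fin n)} (h1 : φ ∈ permSet n b) :
    φ⁻¹ ∈ permSet n b := by
  simp only [permSet, Finset.mem_filter, Finset.mem_univ, true_and] at *
  intro i hi
  rw [Equiv.Perm.inv_eq_iff_eq, h1 i hi]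

lemma finset_rank {α : Type*} (M : Finset α) (f : α → ℝ) (t : ℝ) (ht : 0 ≤ t) :
    (((M.filter fun φ => ((M.filter fun ψ => f φ ≤ f ψ).card : ℝ) ≤ t)).card : ℝ) ≤ t := by
  set B := M.filter fun φ => ((M.filter fun ψ => f φ ≤ f ψ).card : ℝ) ≤ t with hB
  rcases B.eq_empty_or_nonempty with h | h
  · rw [h]; simpa using ht
  obtain ⟨x, hx, hmin⟩ := B.exists_min_image f h
  have hx' := (Finset.mem_filter.1 hx).2
  refine le_trans ?_ hx'
  norm_cast
  apply Finset.card_le_card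
  intro y hy
  exact Finset.mem_filter.2 ⟨(Finset.mem_filter.1 hy).1, hmin y hy⟩

lemma disc_valid {n : ℕ} (b : ℕ) (v : Fin n → ℝ≥0)
    (v0 : ℝ≥0) (hv : ∀ i : Fin n, ¬ ((i : ℕ) < n - b) → v i = v0)
    (u : (Fin n → ℝ) → ℝ) (hu : Measurable u) (t : ℝ) (ht : 0 ≤ t) :
    MeasurableSet {w | ((permSet n b).card : ℝ)⁻¹ *
      (∑ ψ ∈ permSet n b, if u w ≤ u (w ∘ ψ) then (1 : ℝ) else 0) ≤ t} ∧
    (Measure.pi fun i => gaussianReal 0 (v i))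
      {w | ((permSet n b).card : ℝ)⁻¹ *
      (∑ ψ ∈ permSet n b, if u w ≤ u (w ∘ ψ) then (1 : ℝ) else 0) ≤ t} ≤ ENNReal.ofReal t := by
  set S := {w | ((permSet n b).card : ℝ)⁻¹ *
      (∑ ψ ∈ permSet n b, if u w ≤ u (w ∘ ψ) then (1 : ℝ) else 0) ≤ t} with hSdef
  set P := Measure.pi fun i => gaussianReal 0 (v i)
  have hcomp : ∀ ψ : Equiv.Perm (Fin n), Measurable fun w : Fin n → ℝ => w ∘ ψ := fun ψ =>
    measurable_pi_lambda _ fun i => measurable_pi_apply _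
  have hS : MeasurableSet S := by
    refine measurableSet_le (Measurable.const_mul (Finset.measurable_sum _ fun ψ _ => ?_) _)
      measurable_const
    exact Measurable.ite (measurableSet_le hu (hu.comp (hcomp ψ))) measurable_const measurable_const
  refine ⟨hS, ?_⟩
  set M := permSet n b with hM
  have hcard : (0 : ℝ) < (M.card : ℝ) := by
    exact_mod_cast Finset.card_pos.2 ⟨1, one_mem_permSet n b⟩
  have hvψ : ∀ ψ ∈ M, ∀ i, v (ψ i) = v i := by
    intro ψ hψ i
    have hψ' : ∀ i : Fin n, (i : ℕ) < n - b → ψ i = i := by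
      simpa [hM, permSet] using hψ
    by_cases hi : (i : ℕ) < n - b
    · rw [hψ' i hi]
    · have : ¬ ((ψ i : Fin n) : ℕ) < n - b := by
        intro h
        have h2 := hψ' _ h
        have := ψ.injective h2
        rw [this] at h
        exact hi h
      rw [hv _ this, hv _ hi]
  have hinv : ∀ ψ ∈ M, MeasurePreserving (fun w : Fin n → ℝ => w ∘ ψ) P P := by
    intro ψ hψ
    have h := measurePreserving_piCongrLeft (fun i => gaussianReal 0 (v i)) ψ.symm
    have e1 : (fun i => gaussianReal 0 (v (ψ.symm i))) = fun i => gaussianReal 0 (v i) := by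
      funext i
      rw [← hvψ ψ hψ (ψ.symm i), Equiv.apply_symm_apply]
    rw [e1] at h
    convert h using 1
    funext w i
    rw [show i = ψ.symm (ψ i) by simp]
    simp [MeasurableEquiv.piCongrLeft, Equiv.piCongrLeft_apply_apply, -Equiv.symm_apply_apply]
  have hpt : ∀ w : Fin n → ℝ, ∑ φ ∈ M, S.indicator (1 : (Fin n → ℝ) → ℝ≥0∞) (w ∘ φ)
      ≤ ENNReal.ofReal (M.card * t) := by
    intro w
    have hmem : ∀ φ ∈ M, (w ∘ φ ∈ S ↔
        (((M.filter fun ψ : Equiv.Perm (Fin n) => u (w ∘ φ) ≤ u (w ∘ ψ)).card : ℝ)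
          ≤ M.card * t)) := by
      intro φ hφ
      have : (∑ ψ ∈ M, if u (w ∘ φ) ≤ u ((w ∘ φ) ∘ ψ) then (1 : ℝ) else 0) =
          ∑ ψ ∈ M, if u (w ∘ φ) ≤ u (w ∘ ψ) then (1 : ℝ) else 0 := by
        refine Finset.sum_bij' (fun ψ _ => φ * ψ) (fun ψ _ => φ⁻¹ * ψ)
          (fun ψ hψ => mul_mem_permSet hφ hψ)
          (fun ψ hψ => mul_mem_permSet (inv_mem_permSet hφ) hψ) ?_ ?_ ?_
        · intro ψ _; simp
        · intro ψ _; simp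
        · intro ψ _; rfl
      simp only [hSdef, Set.mem_ofPred_eq]
      rw [this, Finset.sum_boole, inv_mul_le_iff₀ hcard]
    have h1 : ∑ φ ∈ M, S.indicator (1 : (Fin n → ℝ) → ℝ≥0∞) (w ∘ φ) =
        ((M.filter fun φ : Equiv.Perm (Fin n) =>
          ((M.filter fun ψ : Equiv.Perm (Fin n) => u (w ∘ φ) ≤ u (w ∘ ψ)).card : ℝ)
          ≤ M.card * t).card : ℝ≥0∞) := by
      rw [← Finset.sum_boole]
      refine Finset.sum_congr rfl fun φ hφ => ?_
      simp only [Set.indicator, hmem φ hφ, Pi.one_apply]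
    rw [h1, ← ENNReal.ofReal_natCast]
    exact ENNReal.ofReal_le_ofReal
      (finset_rank M (fun φ : Equiv.Perm (Fin n) => u (w ∘ φ)) _ (by positivity))
  have hsum : (M.card : ℝ≥0∞) * P S ≤ (M.card : ℝ≥0∞) * ENNReal.ofReal t := by
    calc (M.card : ℝ≥0∞) * P S = ∑ φ ∈ M, P S := by simp
      _ = ∑ φ ∈ M, ∫⁻ w, S.indicator (1 : (Fin n → ℝ) → ℝ≥0∞) (w ∘ φ) ∂P := by
          refine Finset.sum_congr rfl fun φ hφ => ?_
          rw [(hinv φ hφ).lintegral_comp (measurable_one.indicator hS), lintegral_indicator_one hS]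
      _ = ∫⁻ w, ∑ φ ∈ M, S.indicator (1 : (Fin n → ℝ) → ℝ≥0∞) (w ∘ φ) ∂P := by
          rw [lintegral_finsetSum]
          intro φ _
          exact (measurable_one.indicator hS).comp (hcomp φ)
      _ ≤ ∫⁻ w, ENNReal.ofReal (M.card * t) ∂P := lintegral_mono hpt
      _ = _ := by
          rw [lintegral_const, ENNReal.ofReal_mul (by positivity), ENNReal.ofReal_natCast]
          simp [P]
  exact (ENNReal.mul_le_mul_iff_right (by exact_mod_cast hcard.ne') (by simp)).1 hsum

end PPT

namespace PPT

open scoped ENNReal NNReal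

lemma pdf_rel (a c : ℝ≥0) (ha : a ≠ 0) (hc : c ≠ 0) (x : ℝ) :
    gaussianPDFReal 0 c x =
      √(a / c) * Real.exp ((1 / 2) * ((1 / a - 1 / c) * x ^ 2)) * gaussianPDFReal 0 a x := by
  have ha' : (0 : ℝ) < a := by positivity
  have hc' : (0 : ℝ) < c := by positivity
  simp only [gaussianPDFReal]
  have h1 : √(a / c : ℝ) * (√(2 * Real.pi * a))⁻¹ = (√(2 * Real.pi * c))⁻¹ := by
    rw [← Real.sqrt_inv, ← Real.sqrt_inv, ← Real.sqrt_mul (by positivity)]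
    congr 1
    field_simp
  have h2 : Real.exp ((1 / 2) * ((1 / a - 1 / c) * x ^ 2)) * Real.exp (-(x - 0) ^ 2 / (2 * a)) =
      Real.exp (-(x - 0) ^ 2 / (2 * c)) := by
    rw [← Real.exp_add]
    congr 1
    field_simp
    ring
  rw [← h1, ← h2]
  ring

lemma density_rel {n : ℕ} (v0 v1 : Fin n → ℝ≥0) (h0 : ∀ i, v0 i ≠ 0) (h1 : ∀ i, v1 i ≠ 0)
    (x : Fin n → ℝ) :
    ∏ i, gaussianPDF 0 (v1 i) (x i) =
      ENNReal.ofReal ((∏ i, √((v0 i : ℝ) / v1 i)) *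
        Real.exp ((1 / 2) * ∑ i, (1 / (v0 i : ℝ) - 1 / v1 i) * x i ^ 2)) *
      ∏ i, gaussianPDF 0 (v0 i) (x i) := by
  unfold gaussianPDF
  rw [← ENNReal.ofReal_prod_of_nonneg (fun i _ => gaussianPDFReal_nonneg _ _ _),
    ← ENNReal.ofReal_prod_of_nonneg (fun i _ => gaussianPDFReal_nonneg _ _ _),
    ← ENNReal.ofReal_mul (by positivity)]
  congr 1
  rw [Finset.mul_sum, Real.exp_sum, ← Finset.prod_mul_distrib, ← Finset.prod_mul_distrib]
  exact Finset.prod_congr rfl fun i _ => pdf_rel _ _ (h0 i) (h1 i) _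

lemma measurable_dens {n : ℕ} (v : Fin n → ℝ≥0) :
    Measurable fun x : Fin n → ℝ => ∏ i, gaussianPDF 0 (v i) (x i) :=
  Finset.measurable_prod _ fun i _ => (measurable_gaussianPDF 0 (v i)).comp (measurable_pi_apply i)

lemma compare_lower {n : ℕ} (v0 v1 : Fin n → ℝ≥0) (h0 : ∀ i, v0 i ≠ 0) (h1 : ∀ i, v1 i ≠ 0)
    (hle : ∀ i, v0 i ≤ v1 i) (A : Set (Fin n → ℝ)) (hA : MeasurableSet A) :
    ENNReal.ofReal (∏ i, √((v0 i : ℝ) / v1 i)) * (Measure.pi fun i => gaussianReal 0 (v0 i)) A ≤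
      (Measure.pi fun i => gaussianReal 0 (v1 i)) A := by
  rw [pi_gauss_density v0 h0, pi_gauss_density v1 h1, withDensity_apply _ hA,
    withDensity_apply _ hA, ← lintegral_const_mul _ (measurable_dens v0)]
  refine lintegral_mono fun x => ?_
  simp only
  rw [density_rel v0 v1 h0 h1 x]
  gcongr
  refine le_mul_of_one_le_right (by positivity) (Real.one_le_exp ?_)
  refine mul_nonneg (by norm_num) (Finset.sum_nonneg fun i _ => mul_nonneg ?_ (sq_nonneg _))
  rw [sub_nonneg]
  have : (0 : ℝ) < v0 i := by have := h0 i; positivity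
  exact one_div_le_one_div_of_le this (by exact_mod_cast hle i)

lemma compare_upper {n : ℕ} (v0 v1 : Fin n → ℝ≥0) (h0 : ∀ i, v0 i ≠ 0) (h1 : ∀ i, v1 i ≠ 0)
    (A : Set (Fin n → ℝ)) (hA : MeasurableSet A) (L : ℝ)
    (hL : ∀ x ∈ A, ∑ i, (1 / (v0 i : ℝ) - 1 / v1 i) * x i ^ 2 ≤ L) :
    (Measure.pi fun i => gaussianReal 0 (v1 i)) A ≤
    ENNReal.ofReal ((∏ i, √((v0 i : ℝ) / v1 i)) * Real.exp ((1 / 2) * L)) *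
      (Measure.pi fun i => gaussianReal 0 (v0 i)) A := by
  rw [pi_gauss_density v0 h0, pi_gauss_density v1 h1, withDensity_apply _ hA,
    withDensity_apply _ hA, ← lintegral_const_mul _ (measurable_dens v0)]
  refine setLIntegral_mono' hA fun x hx => ?_
  rw [density_rel v0 v1 h0 h1 x]
  have := hL x hx
  gcongr

/-- Indices of the last `b` coordinates. -/
def tailEquiv (n b : ℕ) (hb2 : b ≤ n) : Fin b ≃ {i : Fin n // ¬ ((i : ℕ) < n - b)} where
  toFun j := ⟨⟨n - b + j, by omega⟩, by simp⟩
  invFun i := ⟨(i : Fin n) - (n - b), by have := i.1.2; have := i.2; omega⟩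
  left_inv j := by ext; simp
  right_inv i := by
    have := i.2
    ext; simp; omega

lemma chiSq_eq_map (n b : ℕ) (hb2 : b ≤ n) :
    chiSq b = (stdGaussianPi n).map (tailNormSq b) := by
  classical
  have mp1 := measurePreserving_piEquivPiSubtypeProd (fun _ : Fin n => gaussianReal 0 1)
    (fun i => (i : ℕ) < n - b)
  have mp2 := measurePreserving_snd.comp mp1
  have mp3 := measurePreserving_piCongrLeft
    (fun _ : {i : Fin n // ¬ ((i : ℕ) < n - b)} => gaussianReal 0 1) (tailEquiv n b hb2)
  have hm : Measurable fun t : {i : Fin n // ¬ ((i : ℕ) < n - b)} → ℝ => ∑ i, t i ^ 2 := by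
    fun_prop
  have e1 : (tailNormSq b : (Fin n → ℝ) → ℝ) =
      (fun t : {i : Fin n // ¬ ((i : ℕ) < n - b)} → ℝ => ∑ i, t i ^ 2) ∘
      (Prod.snd ∘ MeasurableEquiv.piEquivPiSubtypeProd (fun _ : Fin n => ℝ)
        (fun i => (i : ℕ) < n - b)) := by
    funext g
    rw [tailNormSq_eq]; rfl
  have e2 : (fun g : Fin b → ℝ => ∑ i, g i ^ 2) =
      (fun t : {i : Fin n // ¬ ((i : ℕ) < n - b)} → ℝ => ∑ i, t i ^ 2) ∘
      (MeasurableEquiv.piCongrLeft (fun _ => ℝ) (tailEquiv n b hb2)) := by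
    funext g
    simp only [Function.comp_apply]
    rw [← Equiv.sum_comp (tailEquiv n b hb2)]
    refine Finset.sum_congr rfl fun i _ => ?_
    simp [MeasurableEquiv.piCongrLeft, Equiv.piCongrLeft_apply_apply]
  unfold chiSq stdGaussianPi
  rw [e1, e2, ← Measure.map_map hm mp2.measurable, ← Measure.map_map hm mp3.measurable,
    mp2.map_eq, mp3.map_eq]

lemma measurable_tailNormSq {n : ℕ} (b : ℕ) :
    Measurable (tailNormSq b : (Fin n → ℝ) → ℝ) := by
  unfold tailNormSq; fun_prop

instance instChiProb (k : ℕ) : IsProbabilityMeasure (chiSq k) :=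
  Measure.isProbabilityMeasure_map (Measurable.aemeasurable (by fun_prop))

lemma chiSq_quantile (b : ℕ) (α0 : ℝ) (hα0 : α0 ∈ Set.Ioo (0 : ℝ) 1) :
    0 ≤ chiSqQuantile b (1 - α0) ∧
      chiSq b (Set.Ioi (chiSqQuantile b (1 - α0))) ≤ ENNReal.ofReal α0 := by
  set A := {x : ℝ | ENNReal.ofReal (1 - α0) ≤ chiSq b (Set.Iic x)} with hA
  set Q := chiSqQuantile b (1 - α0) with hQ
  have hQA : Q = sInf A := rfl
  have hα1 := hα0.1
  have hα2 := hα0.2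
  have hlow : ∀ x ∈ A, 0 ≤ x := by
    intro x hx
    by_contra hneg
    push Not at hneg
    have h0 : chiSq b (Set.Iic x) = 0 := by
      unfold chiSq
      rw [Measure.map_apply (by fun_prop) measurableSet_Iic]
      convert measure_empty (μ := stdGaussianPi b)
      ext g
      simp only [Set.mem_preimage, Set.mem_Iic, Set.mem_empty_iff_false, iff_false, not_le]
      exact lt_of_lt_of_le hneg (Finset.sum_nonneg fun _ _ => sq_nonneg _)
    have hx' : ENNReal.ofReal (1 - α0) ≤ chiSq b (Set.Iic x) := hx
    rw [h0] at hx'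
    simp at hx'
    linarith
  have hne : A.Nonempty := by
    have ht := tendsto_measure_Iic_atTop (chiSq b)
    rw [measure_univ] at ht
    have hlt : ENNReal.ofReal (1 - α0) < 1 := by
      rw [← ENNReal.ofReal_one]
      exact (ENNReal.ofReal_lt_ofReal_iff one_pos).2 (by linarith)
    obtain ⟨x, hx⟩ := (ht.eventually (lt_mem_nhds hlt)).exists
    exact ⟨x, hx.le⟩
  have hbdd : BddBelow A := ⟨0, hlow⟩
  refine ⟨by rw [hQA]; exact le_csInf hne hlow, ?_⟩
  have hcdf : 1 - α0 ≤ cdf (chiSq b) Q := by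
    have hrc : Tendsto (cdf (chiSq b)) (nhdsWithin Q (Set.Ioi Q)) (nhds (cdf (chiSq b) Q)) :=
      ((cdf (chiSq b)).right_continuous Q).mono_left (nhdsWithin_mono _ Set.Ioi_subset_Ici_self)
    refine ge_of_tendsto hrc ?_
    filter_upwards [self_mem_nhdsWithin] with y hy
    have hy' : sInf A < y := hy
    obtain ⟨x, hx, hxy⟩ := exists_lt_of_csInf_lt hne hy'
    rw [cdf_eq_real]
    have : ENNReal.ofReal (1 - α0) ≤ chiSq b (Set.Iic y) :=
      le_trans hx (measure_mono (Set.Iic_subset_Iic.2 hxy.le))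
    exact (ENNReal.ofReal_le_iff_le_toReal (measure_ne_top _ _)).1 this
  rw [cdf_eq_real] at hcdf
  have hc : (chiSq b).real (Set.Ioi Q) = 1 - (chiSq b).real (Set.Iic Q) := by
    rw [← Set.compl_Iic, probReal_compl_eq_one_sub measurableSet_Iic]
  rw [← ofReal_measureReal]
  exact ENNReal.ofReal_le_ofReal (by linarith)

lemma combine (p q D M α0 : ℝ) (hq0 : 0 ≤ q) (hq1 : q ≤ 1) (hD : 0 < D) (hD1 : D ≤ 1)
    (hM : 1 ≤ M) (h1 : p ≤ α0 + D * M * q) (h2 : D * (1 - q) ≤ 1 - p) (hα : 0 ≤ α0) :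
    p ≤ q + ((1 / 2) * M - 1 / 2) + α0 := by
  by_cases hDM : D * M ≤ 1
  · nlinarith
  push Not at hDM
  by_cases hq : q ≤ 1 / 2
  · have : D * M ≤ M := by nlinarith
    nlinarith
  · push Not at hq
    have h3 : 1 - D ≤ M - 1 := by nlinarith [sq_nonneg (M - 1)]
    nlinarith

/-- The core comparison in the latent coordinates. -/
lemma core {n : ℕ} (b : ℕ) (hb2 : b ≤ n) (s : Fin n → ℝ) (s0 : ℝ) (hs0 : 0 < s0)
    (hs : ∀ i, s0 ≤ s i) (ω : ℝ) (hω0 : 0 ≤ ω)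
    (hω : ∀ i : Fin n, ¬ ((i : ℕ) < n - b) → s i ≤ s0 * (1 + ω))
    (α0 : ℝ) (hα0 : α0 ∈ Set.Ioo (0 : ℝ) 1)
    (A : Set (Fin n → ℝ)) (hA : MeasurableSet A) (t : ℝ)
    (hval : (Measure.pi fun i : Fin n => gaussianReal 0
      (if (i : ℕ) < n - b then (s i).toNNReal else s0.toNNReal)) A ≤ ENNReal.ofReal t)
    (ht : 0 ≤ t) :
    ((stdGaussianPi n).map fun g i => √(s i) * g i) A ≤
      ENNReal.ofReal (t + ((1 / 2) * Real.exp ((1 / 2) * ω * chiSqQuantile b (1 - α0)) - 1 / 2)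
        + α0) := by
  obtain ⟨hQ0, hQ⟩ := chiSq_quantile b α0 hα0
  set Q := chiSqQuantile b (1 - α0)
  set v1 : Fin n → ℝ≥0 := fun i => (s i).toNNReal with hv1
  set v0 : Fin n → ℝ≥0 := fun i => if (i : ℕ) < n - b then (s i).toNNReal else s0.toNNReal with hv0
  have hspos : ∀ i, 0 < s i := fun i => hs0.trans_le (hs i)
  have h1ne : ∀ i, v1 i ≠ 0 := fun i => (Real.toNNReal_pos.2 (hspos i)).ne'
  have h0ne : ∀ i, v0 i ≠ 0 := by
    intro i
    simp only [hv0]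
    split_ifs
    · exact h1ne i
    · exact (Real.toNNReal_pos.2 hs0).ne'
  have hle : ∀ i, v0 i ≤ v1 i := by
    intro i
    simp only [hv0]
    split_ifs
    · exact le_rfl
    · exact Real.toNNReal_le_toNNReal (hs i)
  have hmeas : Measurable fun (g : Fin n → ℝ) (i : Fin n) => √(s i) * g i :=
    measurable_pi_lambda _ fun i => by fun_prop
  have hmap : ((stdGaussianPi n).map fun g i => √(s i) * g i) =
      Measure.pi fun i => gaussianReal 0 (v1 i) := by
    unfold stdGaussianPi
    have hg : ∀ i, (gaussianReal 0 1).map (fun x => √(s i) * x) = gaussianReal 0 (v1 i) := by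
      intro i
      rw [gaussianReal_map_const_mul]
      congr 1
      · simp
      · ext
        simp [hv1, Real.sq_sqrt (hspos i).le, (hspos i).le]
    have : ∀ i, SigmaFinite ((gaussianReal 0 1).map (fun x => √(s i) * x)) := by
      intro i; rw [hg]; infer_instance
    have hpm := Measure.pi_map_pi (μ := fun _ : Fin n => gaussianReal 0 1)
      (f := fun i x => √(s i) * x) (fun i => Measurable.aemeasurable (by fun_prop))
    simp_rw [hg] at hpm
    exact hpm
  set P1 := Measure.pi fun i => gaussianReal 0 (v1 i)
  set P0 := Measure.pi fun i => gaussianReal 0 (v0 i) with hP0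
  set D := ∏ i, √((v0 i : ℝ) / v1 i) with hDdef
  have hDpos : 0 < D := by
    refine Finset.prod_pos fun i _ => Real.sqrt_pos.2 ?_
    have := h0ne i; have := h1ne i
    positivity
  have hD1 : D ≤ 1 := by
    refine Finset.prod_le_one (fun i _ => Real.sqrt_nonneg _) fun i _ => ?_
    have := h1ne i
    rw [Real.sqrt_le_iff]
    exact ⟨zero_le_one, by rw [one_pow, div_le_one (by positivity)]; exact_mod_cast hle i⟩
  set E : Set (Fin n → ℝ) := {x | ∑ i, (1 / (v0 i : ℝ) - 1 / v1 i) * x i ^ 2 ≤ ω * Q} with hE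
  have hEm : MeasurableSet E := measurableSet_le (by fun_prop) measurable_const
  have hEc : P1 Eᶜ ≤ ENNReal.ofReal α0 := by
    rw [← hmap, Measure.map_apply hmeas hEm.compl]
    refine le_trans (measure_mono (t := {g | Q < tailNormSq b g}) ?_) (le_trans (le_of_eq ?_) hQ)
    · intro g hg
      simp only [Set.mem_preimage, hE, Set.mem_compl_iff, Set.mem_ofPred_eq, not_le] at hg ⊢
      by_contra hcon
      push Not at hcon
      refine absurd hg (not_lt.2 (le_trans ?_ (mul_le_mul_of_nonneg_left hcon hω0)))
      unfold tailNormSq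
      rw [Finset.mul_sum, Finset.sum_filter]
      refine Finset.sum_le_sum fun i _ => ?_
      have hsi := hspos i
      by_cases hi : (i : ℕ) < n - b
      · have : ¬ (n - b ≤ (i : ℕ)) := by omega
        simp only [hv0, hv1, hi, this, if_true, if_false, sub_self, zero_mul, le_refl]
      · have h' : n - b ≤ (i : ℕ) := by omega
        simp only [hv0, hv1, hi, if_false, h', if_true, mul_pow, Real.sq_sqrt hsi.le,
          Real.coe_toNNReal _ hsi.le, Real.coe_toNNReal _ hs0.le]
        have h3 : (1 / s0 - 1 / s i) * s i ≤ ω := by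
          have : (1 / s0 - 1 / s i) * s i = s i / s0 - 1 := by field_simp
          rw [this, sub_le_iff_le_add, div_le_iff₀ hs0]
          linarith [hω i hi]
        calc _ = ((1 / s0 - 1 / s i) * s i) * g i ^ 2 := by ring
          _ ≤ _ := mul_le_mul_of_nonneg_right h3 (sq_nonneg _)
    · rw [chiSq_eq_map n b hb2, Measure.map_apply (measurable_tailNormSq b) measurableSet_Ioi]
      rfl
  set M := Real.exp ((1 / 2) * ω * Q) with hM
  have hMe : Real.exp ((1 / 2) * (ω * Q)) = M := by rw [hM]; congr 1; ring
  have hM1 : 1 ≤ M := Real.one_le_exp (by positivity)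
  have hup : P1.real A ≤ α0 + D * M * P0.real A := by
    have h1 : P1 A ≤ ENNReal.ofReal α0 + ENNReal.ofReal (D * M) * P0 A := by
      calc P1 A ≤ P1 (Eᶜ ∪ (A ∩ E)) := measure_mono (by
            intro x hx
            by_cases hxE : x ∈ E
            · exact Or.inr ⟨hx, hxE⟩
            · exact Or.inl hxE)
        _ ≤ P1 Eᶜ + P1 (A ∩ E) := measure_union_le _ _
        _ ≤ ENNReal.ofReal α0 + ENNReal.ofReal (D * M) * P0 (A ∩ E) := by
            refine add_le_add hEc ?_
            rw [← hMe]
            exact compare_upper v0 v1 h0ne h1ne (A ∩ E) (hA.inter hEm) _ fun x hx => hx.2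
        _ ≤ _ := by gcongr; exact Set.inter_subset_left
    rw [← ofReal_measureReal, ← ofReal_measureReal (μ := P0), ← ENNReal.ofReal_mul (by positivity),
      ← ENNReal.ofReal_add hα0.1.le (by positivity)] at h1
    refine (ENNReal.ofReal_le_ofReal_iff ?_).1 h1
    have := hα0.1
    positivity
  have hlo : D * (1 - P0.real A) ≤ 1 - P1.real A := by
    have h1 := compare_lower v0 v1 h0ne h1ne hle Aᶜ hA.compl
    rw [← probReal_compl_eq_one_sub hA, ← probReal_compl_eq_one_sub hA]
    change ENNReal.ofReal D * P0 Aᶜ ≤ P1 Aᶜ at h1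
    rw [← ofReal_measureReal, ← ofReal_measureReal (μ := P1),
      ← ENNReal.ofReal_mul (by positivity)] at h1
    exact (ENNReal.ofReal_le_ofReal_iff (by positivity)).1 h1
  have hfin := combine _ _ D M α0 measureReal_nonneg measureReal_le_one hDpos hD1 hM1 hup hlo
    hα0.1.le
  have hq : P0.real A ≤ t := by
    change P0 A ≤ _ at hval
    rw [← ofReal_measureReal] at hval
    exact (ENNReal.ofReal_le_ofReal_iff ht).1 hval
  rw [hmap, ← ofReal_measureReal]
  exact ENNReal.ofReal_le_ofReal (by linarith)

lemma tmul_mul {n : ℕ} (Γ : Fin n → Fin n → ℝ) (h : IsOrthogonalF Γ) (w : Fin n → ℝ) :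
    tmulVecF Γ (mulVecF Γ w) = w := by
  have h1 : (Matrix.of Γ) * (Matrix.of Γ).transpose = 1 := by
    ext i j
    rw [Matrix.mul_apply, Matrix.one_apply]
    exact h i j
  have h2 := mul_eq_one_comm.1 h1
  have e : tmulVecF Γ (mulVecF Γ w) = (Matrix.of Γ).transpose.mulVec ((Matrix.of Γ).mulVec w) := rfl
  rw [e, Matrix.mulVec_mulVec, h2, Matrix.one_mulVec]

lemma R_Sh {n : ℕ} (R Sh : Fin n → Fin n → ℝ) (h : mulF R Sh = idF n) (w : Fin n → ℝ) :
    mulVecF R (mulVecF Sh w) = w := by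
  have h2 : (Matrix.of R) * (Matrix.of Sh) = 1 := by
    ext i j
    rw [Matrix.mul_apply, Matrix.one_apply]
    exact congrFun (congrFun h i) j
  have e : mulVecF R (mulVecF Sh w) = (Matrix.of R).mulVec ((Matrix.of Sh).mulVec w) := rfl
  rw [e, Matrix.mulVec_mulVec, h2, Matrix.one_mulVec]

lemma measurable_mulVecF {n m : ℕ} (A : Fin n → Fin m → ℝ) : Measurable (mulVecF A) := by
  refine measurable_pi_lambda _ fun i => ?_
  unfold mulVecF
  fun_prop

end PPT
open PPT in
/-- Theorem 8, `thm:gp_finite_property_theorem_corr`: under the Gaussian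
process regression null model with correlated noise, where
`Y ~ N(0, (δ₀²/n^{1-γ}) Kₙ + σ₀² Σ)`, the corrected partial permutation p-value
`p̃_c = p + ṽ_C(b, ξₙ, Σ, α₀) + α₀`, computed from `Y^C = Σ^{-1/2} Y` with kernel matrix
`Kₙ^C = Σ^{-1/2} Kₙ Σ^{-1/2}`, is valid.  The law of `Y` is realized through the
eigendecomposition `Kₙ^C = Γ diag(c) Γᵀ`: `Y = Σ^{1/2} Γ (√(δ₀²c_i/n^{1-γ} + σ₀²) g_i)_i` for a
standard Gaussian vector `g`, which has exactly the stated covariance. -/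
theorem partial_permutation_valid_GPR_corrected_correlated
    {n d H : ℕ} (hn : 1 ≤ n)
    (X : Fin n → Fin d → ℝ) (Z : Fin n → Fin H)
    -- variance parameters of the GPR model
    (δ0 σ0 : ℝ) (hδ0 : 0 < δ0) (hσ0 : 0 < σ0) (γ : ℝ)
    -- known positive definite covariance structure Σ, with square root Sh = Σ^{1/2} and
    -- inverse square root R = Σ^{-1/2}
    (Sig Sh R : Fin n → Fin n → ℝ)
    (hSig : IsPosDefF Sig) (hSqrt : IsSqrtPair Sig Sh R)
    -- a symmetric positive semidefinite kernel, its sample kernel matrix, and the transformed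
    -- kernel matrix Kₙ^C = Σ^{-1/2} Kₙ Σ^{-1/2}
    (K : (Fin d → ℝ) → (Fin d → ℝ) → ℝ) (hK : IsPSDKernel K)
    (Kn KnC : Fin n → Fin n → ℝ) (hKn : ∀ i j, Kn i j = K (X i) (X j))
    (hKnC : KnC = mulF R (mulF Kn R))
    -- a fixed eigendecomposition Kₙ^C = Γ diag(c) Γᵀ
    (Γ : Fin n → Fin n → ℝ) (c : Fin n → ℝ) (hEig : IsEigenDecomp KnC Γ c)
    -- the law of Y : multivariate Gaussian, mean 0, covariance (δ₀²/n^{1-γ}) Kₙ + σ₀² Σ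
    (μY : Measure (Fin n → ℝ))
    (hμY : μY = Measure.map
      (fun g : Fin n → ℝ =>
        mulVecF Sh (mulVecF Γ fun i =>
          Real.sqrt (δ0 ^ 2 / (n : ℝ) ^ ((1 : ℝ) - γ) * c i + σ0 ^ 2) * g i))
      (stdGaussianPi n))
    -- permutation size
    (b : ℕ) (hb1 : 1 ≤ b) (hb2 : b ≤ n)
    -- arbitrary (measurable) test statistic
    (T : (Fin n → Fin d → ℝ) → (Fin n → ℝ) → (Fin n → Fin H) → ℝ)
    (hT : Measurable fun y => T X y Z)
    -- correction level α₀
    (α0 : ℝ) (hα0 : α0 ∈ Set.Ioo (0 : ℝ) 1)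
    -- ξₙ = (δ₀²/n^{1-γ})/σ₀², ω̃_C(b, ξₙ, Σ) = ξₙ · ζ_{n-b+1} (the (n-b+1)-th largest
    -- eigenvalue of Kₙ^C), and the correction term ṽ_C(b, ξₙ, Σ, α₀)
    (ξ ωt vt : ℝ)
    (hξ : ξ = (δ0 ^ 2 / (n : ℝ) ^ ((1 : ℝ) - γ)) / σ0 ^ 2)
    (hωt : ωt = ξ * c ⟨n - b, by omega⟩)
    (hvt : vt = (1 / 2) * Real.exp ((1 / 2) * ωt * chiSqQuantile b (1 - α0)) - 1 / 2) :
    -- validity of the corrected p-values, computed from Y^C = Σ^{-1/2} Y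
    ∀ α ∈ Set.Ioo (0 : ℝ) 1,
      μY {y | pDisc X Z T Γ b (mulVecF R y) + vt + α0 ≤ α} ≤ ENNReal.ofReal α ∧
      μY {y | pCont X Z T Γ b (mulVecF R y) + vt + α0 ≤ α} ≤ ENNReal.ofReal α := by
  intro α hα
  obtain ⟨hΓ, -, hmono, hc0⟩ := hEig
  have hQ0 := (chiSq_quantile b α0 hα0).1
  have ha : 0 ≤ δ0 ^ 2 / (n : ℝ) ^ ((1 : ℝ) - γ) := by positivity
  set a := δ0 ^ 2 / (n : ℝ) ^ ((1 : ℝ) - γ) with hadef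
  set s : Fin n → ℝ := fun i => a * c i + σ0 ^ 2 with hs
  have hσ2 : 0 < σ0 ^ 2 := by positivity
  have hss : ∀ i, σ0 ^ 2 ≤ s i := by
    intro i
    have := mul_nonneg ha (hc0 i)
    simp only [hs]; linarith
  have hω0 : 0 ≤ ωt := by
    rw [hωt, hξ]
    exact mul_nonneg (div_nonneg ha hσ2.le) (hc0 _)
  have hω : ∀ i : Fin n, ¬ ((i : ℕ) < n - b) → s i ≤ σ0 ^ 2 * (1 + ωt) := by
    intro i hi
    have h1 : c i ≤ c ⟨n - b, by omega⟩ := hmono _ _ (by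
      rw [Fin.le_def]; exact not_lt.1 hi)
    have h2 : σ0 ^ 2 * (1 + ωt) = σ0 ^ 2 + a * c ⟨n - b, by omega⟩ := by
      rw [hωt, hξ]; field_simp
    rw [h2]
    have := mul_le_mul_of_nonneg_left h1 ha
    simp only [hs]; linarith
  have hvt0 : 0 ≤ vt := by
    rw [hvt]
    have := Real.one_le_exp (x := (1 / 2) * ωt * chiSqQuantile b (1 - α0)) (by positivity)
    linarith
  set u : (Fin n → ℝ) → ℝ := fun w => T X (mulVecF Γ w) Z with hu
  have hum : Measurable u := hT.comp (measurable_mulVecF Γ)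
  have hgm : Measurable fun (g : Fin n → ℝ) (i : Fin n) => √(s i) * g i :=
    measurable_pi_lambda _ fun i => by fun_prop
  have hLm : Measurable fun w => mulVecF Sh (mulVecF Γ w) :=
    (measurable_mulVecF Sh).comp (measurable_mulVecF Γ)
  have hYw : μY = ((stdGaussianPi n).map fun g i => √(s i) * g i).map
      (fun w => mulVecF Sh (mulVecF Γ w)) := by
    rw [Measure.map_map hLm hgm, hμY]
    rfl
  have hRm : Measurable fun y => tmulVecF Γ (mulVecF R y) := by
    have : Measurable (tmulVecF Γ) := by
      refine measurable_pi_lambda _ fun i => ?_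
      unfold tmulVecF
      fun_prop
    exact this.comp (measurable_mulVecF R)
  have hRS : ∀ w, mulVecF R (mulVecF Sh w) = w := R_Sh R Sh hSqrt.2.2.1
  have hSR : ∀ w, mulVecF Sh (mulVecF R w) = w := R_Sh Sh R hSqrt.2.2.2
  have hGt : ∀ w, mulVecF Γ (tmulVecF Γ w) = w := by
    intro w
    have h1 : (Matrix.of Γ) * (Matrix.of Γ).transpose = 1 := by
      ext i j
      rw [Matrix.mul_apply, Matrix.one_apply]
      exact hΓ i j
    have e : mulVecF Γ (tmulVecF Γ w) =
      (Matrix.of Γ).mulVec ((Matrix.of Γ).transpose.mulVec w) := rfl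
    rw [e, Matrix.mulVec_mulVec, h1, Matrix.one_mulVec]
  -- reduction for an arbitrary nonnegative p-value
  have main : ∀ p : (Fin n → ℝ) → ℝ, (∀ y, 0 ≤ p y) →
      (∀ t : ℝ, 0 ≤ t → MeasurableSet {w | p (mulVecF Γ w) ≤ t} ∧
        (Measure.pi fun i : Fin n => gaussianReal 0
          (if (i : ℕ) < n - b then (s i).toNNReal else (σ0 ^ 2).toNNReal))
          {w | p (mulVecF Γ w) ≤ t} ≤ ENNReal.ofReal t) →
      μY {y | p (mulVecF R y) + vt + α0 ≤ α} ≤ ENNReal.ofReal α := by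
    intro p hp hval
    by_cases ht : 0 ≤ α - vt - α0
    · obtain ⟨hAm, hAv⟩ := hval _ ht
      set A := {w | p (mulVecF Γ w) ≤ α - vt - α0} with hAdef
      have hset : {y | p (mulVecF R y) + vt + α0 ≤ α} =
          (fun y => tmulVecF Γ (mulVecF R y)) ⁻¹' A := by
        ext y
        simp only [hAdef, Set.mem_preimage, Set.mem_ofPred_eq, hGt]
        constructor <;> intro h <;> linarith
      rw [hset, hYw, Measure.map_apply hLm (hRm hAm)]
      have hpre : (fun w => mulVecF Sh (mulVecF Γ w)) ⁻¹'
          ((fun y => tmulVecF Γ (mulVecF R y)) ⁻¹' A) = A := by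
        ext w
        simp only [Set.mem_preimage, hRS, tmul_mul Γ hΓ]
      rw [hpre]
      have := core b hb2 s (σ0 ^ 2) hσ2 hss ωt hω0 hω α0 hα0 A hAm _ hAv ht
      refine this.trans (le_of_eq ?_)
      rw [← hvt]
      congr 1
      ring
    · have : {y | p (mulVecF R y) + vt + α0 ≤ α} = ∅ := by
        ext y
        simp only [Set.mem_ofPred_eq, Set.mem_empty_iff_false, iff_false, not_le]
        have := hp (mulVecF R y)
        linarith
      rw [this]
      simp
  have hv0ne : (σ0 ^ 2).toNNReal ≠ 0 := (Real.toNNReal_pos.2 hσ2).ne'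
  constructor
  · refine main (pDisc X Z T Γ b) ?_ ?_
    · intro y
      unfold pDisc
      refine mul_nonneg (by positivity) (Finset.sum_nonneg fun ψ _ => ?_)
      split_ifs <;> norm_num
    · intro t ht
      have := disc_valid b (fun i : Fin n =>
        if (i : ℕ) < n - b then (s i).toNNReal else (σ0 ^ 2).toNNReal) (σ0 ^ 2).toNNReal
        (fun i hi => if_neg hi) u hum t ht
      simpa only [pDisc, tmul_mul Γ hΓ, hu] using this
  · refine main (pCont X Z T Γ b) ?_ ?_
    · intro y
      exact ENNReal.toReal_nonneg
    · intro t ht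
      have := cont_valid b hb1 hb2 (fun i : Fin n =>
        if (i : ℕ) < n - b then (s i).toNNReal else (σ0 ^ 2).toNNReal) (σ0 ^ 2).toNNReal hv0ne
        (fun i hi => if_neg hi) u hum t ht
      simpa only [pCont, tmul_mul Γ hΓ, hu] using this
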